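/- Let A > 1, a = (A + 1/A)/2, and f_A(z) = (A − 1/φ(z))^{−1/2} for z ∈ ℂ∖[−1,1] (principal square root). For x ∈ (−1,1), write f_A⁺(x) = lim_{ε→0⁺} f_A(x+iε) and f_A⁻(x) = lim_{ε→0⁺} f_A(x−iε). Then for every x ∈ (−1,1): f_A⁺(x) + f_A⁻(x) = h_A(x) / √(2A(a−x)). -/

import Mathlib

open Complex Filter Topology

/-- The inverse Zhukovskii function `φ(z) = z + (z²−1)^{1/2}`, the branch of the square
root fixed by `(z²−1)^{1/2} := z·(1 − z⁻²)^{1/2}` with the principal square root. -/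
noncomputable def phi (z : ℂ) : ℂ := z + z * (1 - 1 / z ^ 2) ^ ((1 : ℂ) / 2)

/-- `f_A(z) = (A − 1/φ(z))^{−1/2}`, principal square root. -/
noncomputable def fA (A : ℝ) (z : ℂ) : ℂ := ((A : ℂ) - 1 / phi z) ^ (-(1 / 2) : ℂ)

/-- `h_A(x) = (A − x − i√(1−x²))^{1/2} + (A − x + i√(1−x²))^{1/2}`,
using principal square roots. -/
noncomputable def hfun (A x : ℝ) : ℂ :=
  ((A : ℂ) - x - Complex.I * Real.sqrt (1 - x ^ 2)) ^ ((1 : ℂ) / 2) +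
  ((A : ℂ) - x + Complex.I * Real.sqrt (1 - x ^ 2)) ^ ((1 : ℂ) / 2)

lemma cpow_half_sq (z : ℂ) : (z ^ ((1 : ℂ) / 2)) ^ 2 = z := by
  simp

lemma cpow_half_re_pos {z : ℂ} (hz : z ∈ slitPlane) : 0 < (z ^ ((1 : ℂ) / 2)).re := by
  rw [cpow_def_of_ne_zero (slitPlane_ne_zero hz), exp_re]
  have him : (log z * (1 / 2)).im = arg z / 2 := by
    rw [show (1 / 2 : ℂ) = ((1 / 2 : ℝ) : ℂ) by norm_num, im_mul_ofReal, log_im]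
    ring
  rw [him]
  refine mul_pos (Real.exp_pos _) (Real.cos_pos_of_mem_Ioo ⟨?_, ?_⟩)
  · linarith [neg_pi_lt_arg z]
  · linarith [(arg_le_pi z).lt_of_ne (mem_slitPlane_iff_arg.1 hz).1]

lemma one_sub_sq_mem_slitPlane {z : ℂ} (hz : z.im ≠ 0) : 1 - z ^ 2 ∈ slitPlane := by
  rw [mem_slitPlane_iff]
  by_contra! h
  obtain ⟨h1, h2⟩ := h
  simp only [sq, sub_re, sub_im, mul_re, mul_im, one_re, one_im] at h1 h2
  have h3 : z.re = 0 := by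
    have : z.re * z.im = 0 := by linarith
    exact (mul_eq_zero.1 this).resolve_right hz
  rw [h3] at h1
  nlinarith [sq_nonneg z.im]

/-- In the upper half plane the branch `z (1 - z⁻²)^{1/2}` is `i (1 - z²)^{1/2}`. -/
lemma mul_cpow_half_eq_of_im_pos {z : ℂ} (hz : 0 < z.im) :
    z * (1 - 1 / z ^ 2) ^ ((1 : ℂ) / 2) = I * (1 - z ^ 2) ^ ((1 : ℂ) / 2) := by
  have hz0 : z ≠ 0 := by rintro rfl; simp at hz
  have hinv : (z⁻¹).im ≠ 0 := by
    rw [inv_im]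
    exact div_ne_zero (neg_ne_zero.2 hz.ne') (normSq_pos.2 hz0).ne'
  have hw := cpow_half_re_pos (one_sub_sq_mem_slitPlane hinv)
  have hu := cpow_half_re_pos (one_sub_sq_mem_slitPlane hz.ne')
  rw [show 1 - z⁻¹ ^ 2 = 1 - 1 / z ^ 2 by rw [inv_pow, one_div]] at hw
  have hw2 := cpow_half_sq (1 - 1 / z ^ 2)
  have hu2 := cpow_half_sq (1 - z ^ 2)
  generalize (1 - 1 / z ^ 2) ^ ((1 : ℂ) / 2) = w at *
  generalize (1 - z ^ 2) ^ ((1 : ℂ) / 2) = u at *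
  have hsq : (z * w) ^ 2 = (I * u) ^ 2 := by
    rw [mul_pow, mul_pow, hw2, hu2, I_sq]
    field_simp
    ring
  refine (sq_eq_sq_iff_eq_or_eq_neg.1 hsq).resolve_right fun hneg => ?_
  have hre := congrArg re hneg
  have him := congrArg im hneg
  have hui := congrArg im hu2
  simp [sq] at hre him hui
  have key : (z.re ^ 2 + z.im ^ 2) * w.re = z.re * u.im - z.im * u.re := by
    linear_combination z.re * hre + z.im * him
  have h1 : u.re * (z.re * u.im) = -(z.re ^ 2 * z.im) := by
    linear_combination z.re * hui / 2
  have h2 : 0 < u.re * ((z.re ^ 2 + z.im ^ 2) * w.re) := by positivity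
  rw [key, mul_sub, h1] at h2
  have h3 : 0 ≤ z.re ^ 2 * z.im := by positivity
  have h4 : 0 < u.re * (z.im * u.re) := by positivity
  linarith

lemma phi_neg (z : ℂ) : phi (-z) = -phi z := by
  simp only [phi, neg_sq]
  ring

lemma tendsto_phi_upper {x : ℝ} (hx : x ∈ Set.Ioo (-1 : ℝ) 1) :
    Tendsto (fun ε : ℝ => phi (x + ε * I)) (𝓝[>] 0) (𝓝 (x + I * Real.sqrt (1 - x ^ 2))) := by
  have hpos : 0 < 1 - x ^ 2 := by nlinarith [hx.1, hx.2]
  have hcast : (1 : ℂ) - (x : ℂ) ^ 2 = ((1 - x ^ 2 : ℝ) : ℂ) := by push_cast; rfl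
  have hval : (1 - (x : ℂ) ^ 2) ^ ((1 : ℂ) / 2) = (Real.sqrt (1 - x ^ 2) : ℂ) := by
    rw [hcast, Real.sqrt_eq_rpow, ofReal_cpow hpos.le]
    norm_num
  have hslit : 1 - (x : ℂ) ^ 2 ∈ slitPlane := by
    rw [hcast]
    exact ofReal_mem_slitPlane.2 hpos
  have hlim : Tendsto (fun ε : ℝ => (x : ℂ) + ε * I) (𝓝[>] 0) (𝓝 x) := by
    have : Continuous fun ε : ℝ => (x : ℂ) + ε * I := by fun_prop
    exact (this.tendsto' 0 _ (by simp)).mono_left nhdsWithin_le_nhds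
  have hcont : ContinuousAt (fun z : ℂ => z + I * (1 - z ^ 2) ^ ((1 : ℂ) / 2)) x := by
    have : ContinuousAt (fun z : ℂ => (1 - z ^ 2) ^ ((1 : ℂ) / 2)) x :=
      ContinuousAt.cpow (by fun_prop) continuousAt_const hslit
    fun_prop
  have h := hcont.tendsto.comp hlim
  rw [hval] at h
  refine h.congr' ?_
  filter_upwards [self_mem_nhdsWithin] with ε hε
  have him : 0 < ((x : ℂ) + ε * I).im := by simpa using hε
  simp only [Function.comp_apply, phi, mul_cpow_half_eq_of_im_pos him]

lemma tendsto_phi_lower {x : ℝ} (hx : x ∈ Set.Ioo (-1 : ℝ) 1) :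
    Tendsto (fun ε : ℝ => phi (x - ε * I)) (𝓝[>] 0) (𝓝 (x - I * Real.sqrt (1 - x ^ 2))) := by
  have hx' : -x ∈ Set.Ioo (-1 : ℝ) 1 := ⟨by linarith [hx.2], by linarith [hx.1]⟩
  have h := (tendsto_phi_upper hx').neg
  simp only [← phi_neg, neg_sq, ofReal_neg, neg_add, neg_neg, ← sub_eq_add_neg] at h
  exact h

/-- If `φ` tends to the unit number `u` with inverse `v`, then `f_A` tends to
`((A - v)^{1/2})⁻¹`. -/
lemma tendsto_fA {A : ℝ} {g : ℝ → ℂ} {l : Filter ℝ} {u v : ℂ} (huv : u * v = 1)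
    (hv : A - v ∈ slitPlane) (hg : Tendsto (fun ε => phi (g ε)) l (𝓝 u)) :
    Tendsto (fun ε => fA A (g ε)) l (𝓝 ((A - v) ^ ((1 : ℂ) / 2))⁻¹) := by
  have hu : u ≠ 0 := left_ne_zero_of_mul_eq_one huv
  have h1 : Tendsto (fun ε => (A : ℂ) - 1 / phi (g ε)) l (𝓝 (A - v)) := by
    rw [eq_inv_of_mul_eq_one_right huv, ← one_div]
    exact tendsto_const_nhds.sub (tendsto_const_nhds.div hg hu)
  rw [← cpow_neg]
  exact h1.cpow tendsto_const_nhds hv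

/-- For `A > 1`, `a = (A + 1/A)/2`, `x ∈ (−1,1)`:
`f_A⁺(x) + f_A⁻(x) = h_A(x) / √(2A(a−x))`. -/
theorem fA_sum (A : ℝ) (hA : 1 < A) (x : ℝ) (hx : x ∈ Set.Ioo (-1 : ℝ) 1)
    (p m : ℂ)
    (hp : Tendsto (fun ε : ℝ => fA A ((x : ℂ) + ε * Complex.I)) (𝓝[>] 0) (𝓝 p))
    (hm : Tendsto (fun ε : ℝ => fA A ((x : ℂ) - ε * Complex.I)) (𝓝[>] 0) (𝓝 m)) :
    p + m = hfun A x / (Real.sqrt (2 * A * ((A + 1 / A) / 2 - x)) : ℂ) := by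
  have hpos : 0 < 1 - x ^ 2 := by nlinarith [hx.1, hx.2]
  have hAx : 0 < A - x := by linarith [hx.2]
  have hy : Real.sqrt (1 - x ^ 2) ^ 2 = 1 - x ^ 2 := Real.sq_sqrt hpos.le
  set y := Real.sqrt (1 - x ^ 2) with hydef
  have hyc : (y : ℂ) ^ 2 = 1 - (x : ℂ) ^ 2 := by exact_mod_cast hy
  have hmul : ((x : ℂ) + I * y) * (x - I * y) = 1 := by
    linear_combination hyc - (y : ℂ) ^ 2 * I_sq
  have hslit₁ : (A : ℂ) - (x - I * y) ∈ slitPlane := Or.inl (by simpa using hAx)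
  have hslit₂ : (A : ℂ) - (x + I * y) ∈ slitPlane := Or.inl (by simpa using hAx)
  have hpe := tendsto_nhds_unique hp (tendsto_fA hmul hslit₁ (tendsto_phi_upper hx))
  have hme := tendsto_nhds_unique hm
    (tendsto_fA ((mul_comm _ _).trans hmul) hslit₂ (tendsto_phi_lower hx))
  have hconj : (A : ℂ) - (x + I * y) = (starRingEnd ℂ) (A - (x - I * y)) := by
    simp
  have hroot : ((A : ℂ) - (x + I * y)) ^ ((1 : ℂ) / 2) =
      (starRingEnd ℂ) ((A - (x - I * y)) ^ ((1 : ℂ) / 2)) := by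
    rw [hconj, conj_cpow _ _ (mem_slitPlane_iff_arg.1 hslit₁).1]
    simp [map_ofNat]
  have hsq := cpow_half_sq ((A : ℂ) - (x - I * y))
  have hre := cpow_half_re_pos hslit₁
  rw [hpe, hme, hfun, ← hydef, sub_sub, show (A : ℂ) - x + I * y = A - (x - I * y) by ring, hroot]
  generalize ((A : ℂ) - (x - I * y)) ^ ((1 : ℂ) / 2) = r at *
  have hr : r ≠ 0 := by rintro rfl; simp at hre
  have hnorm : Real.sqrt (2 * A * ((A + 1 / A) / 2 - x)) = normSq r := by
    rw [Real.sqrt_eq_iff_mul_self_eq_of_pos (normSq_pos.2 hr), ← sq, ← map_pow, hsq, normSq_apply]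
    have hA0 : A ≠ 0 := by positivity
    simp
    field_simp
    linear_combination hy
  rw [hnorm, ← mul_conj]
  have hr' : (starRingEnd ℂ) r ≠ 0 := (map_ne_zero _).2 hr
  field_simp
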